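/- For every δ > 0 there is a constant C = C(δ) such that the following holds. Let N ≥ 2 be an integer, let t be a real number with 1 ≤ t ≤ N, and let λ = (λ_{−N},…,λ_N) ∈ ℝ^{2N+1} satisfy the rigidity bound |λ_k − ν(k/N)| ≤ N^{δ/4 − 2/3} (N + 1 − |k|)^{−1/3} for every k ∈ {−N,…,N}. Then sup_{α ∈ ℝ} ∑_{k=−N}^{N} | φ(α + t λ_k) − φ(α + t ν(k/N)) | ≤ C · N^{3δ/4}. -/

import Mathlib

open MeasureTheory

/-- Density of the semicircle measure `σ_sc`. -/
noncomputable def scDensity (x : ℝ) : ℝ := (1 / (2 * Real.pi)) * Real.sqrt (max (4 - x ^ 2) 0)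

/-- `ν : [-1,1] → [-2,2]` is the strictly increasing continuous function with
`∫_0^{ν k} dσ_sc = k/2`. -/
def IsNu (ν : ℝ → ℝ) : Prop :=
  (∀ k ∈ Set.Icc (-1 : ℝ) 1, ν k ∈ Set.Icc (-2 : ℝ) 2) ∧
    StrictMonoOn ν (Set.Icc (-1 : ℝ) 1) ∧
      ContinuousOn ν (Set.Icc (-1 : ℝ) 1) ∧
        ∀ k ∈ Set.Icc (-1 : ℝ) 1, (∫ x in (0 : ℝ)..(ν k), scDensity x) = k / 2

/-- The Fejér-type kernel `φ(x) = sin²(x/2)/x²`, `φ(0) = 1/4`. -/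
noncomputable def fejer (x : ℝ) : ℝ := if x = 0 then 1 / 4 else Real.sin (x / 2) ^ 2 / x ^ 2


noncomputable def scF (x : ℝ) : ℝ := ∫ y in (0 : ℝ)..x, scDensity y

lemma scDensity_cont : Continuous scDensity := by
  unfold scDensity; fun_prop

lemma scDensity_nonneg (x : ℝ) : 0 ≤ scDensity x := by
  unfold scDensity; positivity

lemma scDensity_le (y D : ℝ) (hD : 0 ≤ D) (h : 2 - |y| ≤ D) :
    scDensity y ≤ (1 / Real.pi) * Real.sqrt D := by
  have h1 : max (4 - y ^ 2) 0 ≤ 2 ^ 2 * D := by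
    apply max_le _ (by positivity)
    rw [← sq_abs]
    have := abs_nonneg y
    by_cases h2 : |y| ≤ 2
    · nlinarith
    · push Not at h2
      nlinarith
  have h2 : Real.sqrt (max (4 - y ^ 2) 0) ≤ 2 * Real.sqrt D := by
    calc _ ≤ Real.sqrt (2 ^ 2 * D) := Real.sqrt_le_sqrt h1
      _ = 2 * Real.sqrt D := by
        rw [Real.sqrt_mul (by norm_num), Real.sqrt_sq (by norm_num)]
  unfold scDensity
  have hp := Real.pi_pos
  calc _ ≤ 1 / (2 * Real.pi) * (2 * Real.sqrt D) := by gcongr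
    _ = _ := by field_simp

lemma scDensity_ge (y D : ℝ) (hD : 0 ≤ D) (hy : 0 ≤ y) (h : D / 2 ≤ 2 - y) :
    (1 / (2 * Real.pi)) * Real.sqrt D ≤ scDensity y := by
  unfold scDensity
  have hp := Real.pi_pos
  have : D ≤ max (4 - y ^ 2) 0 := le_trans (by nlinarith) (le_max_left _ _)
  gcongr

lemma scF_sub (x u : ℝ) : scF x - scF u = ∫ y in u..x, scDensity y := by
  unfold scF
  exact intervalIntegral.integral_interval_sub_left
    (scDensity_cont.intervalIntegrable _ _) (scDensity_cont.intervalIntegrable _ _)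

lemma scF_diff (x u : ℝ) (hu : |u| ≤ 2) :
    |scF x - scF u| ≤ (1 / Real.pi) * Real.sqrt (2 - |u| + |x - u|) * |x - u| := by
  rw [scF_sub, ← Real.norm_eq_abs (∫ y in u..x, scDensity y)]
  apply intervalIntegral.norm_integral_le_of_norm_le_const
  intro y hy
  rw [Real.norm_eq_abs, abs_of_nonneg (scDensity_nonneg y)]
  apply scDensity_le
  · have := abs_nonneg (x - u); linarith
  · have h1 : |y - u| ≤ |x - u| :=
      Set.abs_sub_left_of_mem_uIcc (Set.uIoc_subset_uIcc hy)
    have h2 := abs_sub_abs_le_abs_sub u y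
    rw [abs_sub_comm] at h2
    linarith

lemma scF_zero : scF 0 = 0 := by simp [scF]

lemma scF_neg (x : ℝ) : scF (-x) = - scF x := by
  unfold scF
  have := intervalIntegral.integral_comp_neg (f := scDensity) (a := 0) (b := x)
  have he : ∀ y, scDensity (-y) = scDensity y := by intro y; simp [scDensity]
  simp only [he, neg_zero] at this
  rw [this, intervalIntegral.integral_symm]

lemma scF_two : scF 2 = 1 / 2 := by
  have h1 : scF 2 - scF (-2) = 1 := by
    rw [scF_sub]
    have h := intervalIntegral.integral_comp_mul_left (a := -1) (b := 1) scDensity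
      (c := 2) (by norm_num)
    have h2 : ∀ x : ℝ, scDensity (2 * x) = (1 / Real.pi) * Real.sqrt (1 - x ^ 2) := by
      intro x
      unfold scDensity
      have : max (4 - (2 * x) ^ 2) 0 = 2 ^ 2 * max (1 - x ^ 2) 0 := by
        rw [mul_max_of_nonneg _ _ (by norm_num)]; ring_nf
      rw [this, Real.sqrt_mul (by norm_num), Real.sqrt_sq (by norm_num)]
      have h3 : Real.sqrt (max (1 - x ^ 2) 0) = Real.sqrt (1 - x ^ 2) := by
        rcases le_total (1 - x ^ 2) 0 with h | h
        · rw [max_eq_right h, Real.sqrt_eq_zero_of_nonpos h, Real.sqrt_zero]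
        · rw [max_eq_left h]
      rw [h3]
      have hp := Real.pi_pos
      field_simp
    simp only [h2] at h
    rw [intervalIntegral.integral_const_mul, integral_sqrt_one_sub_sq] at h
    have hp := Real.pi_pos
    norm_num at h
    have h4 : Real.pi⁻¹ * (Real.pi / 2) = 1 / 2 := by field_simp
    linarith
  rw [scF_neg] at h1
  linarith

lemma scF_low_nonneg (u : ℝ) (h0 : 0 ≤ u) (hu : u ≤ 2) :
    (2 - u) * Real.sqrt (2 - u) / (4 * Real.pi) ≤ 1 / 2 - scF u := by
  have h1 : scF u + (2 - u) * Real.sqrt (2 - u) / (4 * Real.pi) ≤ scF (u + (2 - u) / 2) := by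
    have := intervalIntegral.integral_mono_on (a := u) (b := u + (2 - u) / 2) (μ := volume)
      (f := fun _ => (1 / (2 * Real.pi)) * Real.sqrt (2 - u)) (g := scDensity) (by linarith)
      (by simp) (scDensity_cont.intervalIntegrable _ _)
      (fun y hy => scDensity_ge y (2 - u) (by linarith) (by linarith [hy.1])
        (by linarith [hy.2]))
    rw [← scF_sub, intervalIntegral.integral_const, smul_eq_mul] at this
    have hp := Real.pi_pos
    have h2 : (u + (2 - u) / 2 - u) * (1 / (2 * Real.pi) * Real.sqrt (2 - u)) =
      (2 - u) * Real.sqrt (2 - u) / (4 * Real.pi) := by field_simp; ring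
    linarith
  have h2 : scF (u + (2 - u) / 2) ≤ scF 2 := by
    have := intervalIntegral.integral_nonneg (μ := volume) (f := scDensity)
      (a := u + (2 - u) / 2) (b := 2) (by linarith) (fun y _ => scDensity_nonneg y)
    rw [← scF_sub] at this
    linarith
  rw [scF_two] at h2
  linarith

lemma scF_nonneg (u : ℝ) (h0 : 0 ≤ u) : 0 ≤ scF u :=
  intervalIntegral.integral_nonneg h0 (fun y _ => scDensity_nonneg y)

lemma abs_scF (u : ℝ) : |scF u| = scF |u| := by
  rcases le_total 0 u with h | h
  · rw [abs_of_nonneg h, abs_of_nonneg (scF_nonneg u h)]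
  · rw [abs_of_nonpos h, scF_neg, abs_of_nonpos]
    have := scF_nonneg (-u) (by linarith)
    rw [scF_neg] at this; linarith

lemma scF_low (u : ℝ) (hu : |u| ≤ 2) :
    (2 - |u|) * Real.sqrt (2 - |u|) ≤ 8 * (1 - 2 * |scF u|) := by
  rw [abs_scF]
  have h := scF_low_nonneg |u| (abs_nonneg u) hu
  have hp := Real.pi_pos
  have hp4 := Real.pi_le_four
  rw [div_le_iff₀ (by positivity)] at h
  have h0 : 0 ≤ (2 - |u|) * Real.sqrt (2 - |u|) :=
    mul_nonneg (by linarith) (Real.sqrt_nonneg _)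
  have h1 : 0 ≤ 1 / 2 - scF |u| := by
    by_contra hc
    push Not at hc
    nlinarith
  nlinarith

lemma inv_pi_sqrt (D : ℝ) : (1 / Real.pi) * Real.sqrt (2 * D) ≤ Real.sqrt D / 2 := by
  have hp := Real.pi_gt_three
  rw [Real.sqrt_mul (by norm_num)]
  have h2 : Real.sqrt 2 ≤ 3 / 2 := by
    rw [Real.sqrt_le_left (by norm_num)]; norm_num
  have h3 : (1 / Real.pi) * Real.sqrt 2 ≤ 1 / 2 := by
    rw [one_div_mul_eq_div, div_le_iff₀ (by linarith)]; linarith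
  have := mul_le_mul_of_nonneg_right h3 (Real.sqrt_nonneg D)
  linarith

lemma scF_up (u : ℝ) (hu : |u| ≤ 2) :
    1 - 2 * |scF u| ≤ (2 - |u|) * Real.sqrt (2 - |u|) := by
  rw [abs_scF]
  have h := scF_diff 2 |u| (by simpa using hu)
  rw [abs_abs, abs_of_nonneg (by linarith : 0 ≤ 2 - |u|), scF_two, ← two_mul] at h
  have h2 := mul_le_mul_of_nonneg_right (inv_pi_sqrt (2 - |u|)) (by linarith : 0 ≤ 2 - |u|)
  have h3 := le_abs_self (1 / 2 - scF |u|)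
  linarith

lemma scF_bound (x : ℝ) (hx : |x| ≤ 2) : |scF x| ≤ 1 / 2 := by
  have h := scF_low x hx
  have h0 : 0 ≤ (2 - |x|) * Real.sqrt (2 - |x|) :=
    mul_nonneg (by linarith) (Real.sqrt_nonneg _)
  linarith

/-- separation -/
lemma scF_sep (x u : ℝ) (hu : |u| ≤ 2) (q : ℝ) (hq : 0 < q)
    (he : 1 - 2 * |scF u| ≤ q ^ 3) (he2 : q ^ 3 / 2 ≤ 1 - 2 * |scF u|) :
    2 * |scF x - scF u| / (4 * q) ≤ |x - u| ∨ q ^ 2 / 4 ≤ |x - u| := by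
  set d := 2 - |u| with hd
  have hd0 : 0 ≤ d := by linarith
  set p := Real.sqrt d with hp
  have hp0 : 0 ≤ p := Real.sqrt_nonneg _
  have hpd : p ^ 2 = d := Real.sq_sqrt hd0
  have h1 := scF_low u hu
  have h2 := scF_up u hu
  rw [← hd, ← hp] at h1 h2
  have h3 : p ≤ 2 * q := by
    apply le_of_pow_le_pow_left₀ (n := 3) (by norm_num) (by positivity)
    nlinarith
  have h4 : q / 2 ≤ p := by
    apply le_of_pow_le_pow_left₀ (n := 3) (by norm_num) (by positivity)
    have : 0 < q ^ 3 := by positivity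
    nlinarith
  rcases le_total |x - u| d with h | h
  · left
    have h5 := scF_diff x u hu
    have h6 : Real.sqrt (2 - |u| + |x - u|) ≤ Real.sqrt (2 * d) :=
      Real.sqrt_le_sqrt (by linarith)
    have h7 := inv_pi_sqrt d
    have hpi := Real.pi_pos
    have h8 : |scF x - scF u| ≤ (p / 2) * |x - u| := by
      calc _ ≤ _ := h5
        _ ≤ (1 / Real.pi) * Real.sqrt (2 * d) * |x - u| := by gcongr
        _ ≤ _ := by gcongr
    rw [div_le_iff₀ (by positivity)]
    have := abs_nonneg (x - u)
    nlinarith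
  · right
    nlinarith

lemma abs_sin_half_div_le (X : ℝ) : |Real.sin (X / 2)| ≤ |X| / 2 := by
  have := Real.abs_sin_le_abs (x := X / 2)
  rwa [abs_div, abs_two] at this

lemma fejer_nonneg (x : ℝ) : 0 ≤ fejer x := by
  unfold fejer; split_ifs <;> positivity

lemma fejer_le (x : ℝ) : fejer x ≤ 1 / 4 := by
  unfold fejer
  split_ifs with h
  · exact le_rfl
  · rw [div_le_iff₀ (by positivity), ← sq_abs, ← sq_abs x]
    have := abs_sin_half_div_le x
    have := abs_nonneg (Real.sin (x / 2))
    nlinarith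

lemma fejer_diff_triv (X Y : ℝ) : |fejer X - fejer Y| ≤ 1 / 4 := by
  rw [abs_le]
  have := fejer_le X
  have := fejer_le Y
  have := fejer_nonneg X
  have := fejer_nonneg Y
  constructor <;> linarith

lemma fejer_diff (X Y : ℝ) (hX : X ≠ 0) : |fejer X - fejer Y| ≤ |X - Y| / |X| := by
  have hX' : 0 < |X| := abs_pos.mpr hX
  by_cases hY : Y = 0
  · subst hY
    rw [sub_zero, div_self hX'.ne']
    have := fejer_diff_triv X 0
    linarith
  have hY' : 0 < |Y| := abs_pos.mpr hY
  have hs : |Real.sin (X / 2) - Real.sin (Y / 2)| ≤ |X - Y| / 2 := by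
    have := Real.abs_sin_sub_sin_le (X / 2) (Y / 2)
    rwa [← sub_div, abs_div, abs_two] at this
  have hb : ∀ Z : ℝ, Z ≠ 0 → |Real.sin (Z / 2) / Z| ≤ 1 / 2 := by
    intro Z hZ
    rw [abs_div, div_le_iff₀ (abs_pos.mpr hZ)]
    have := abs_sin_half_div_le Z
    linarith
  have h1 : fejer X - fejer Y = (Real.sin (X / 2) / X - Real.sin (Y / 2) / Y) *
      (Real.sin (X / 2) / X + Real.sin (Y / 2) / Y) := by
    unfold fejer
    rw [if_neg hX, if_neg hY]
    field_simp
    ring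
  have h2 : Real.sin (X / 2) / X - Real.sin (Y / 2) / Y =
      (Real.sin (X / 2) - Real.sin (Y / 2)) / X + (Real.sin (Y / 2) / Y) * ((Y - X) / X) := by
    field_simp
    ring
  have h3 : |Real.sin (X / 2) / X - Real.sin (Y / 2) / Y| ≤ |X - Y| / |X| := by
    rw [h2]
    refine (abs_add_le _ _).trans ?_
    rw [abs_mul, abs_div (Y - X), abs_sub_comm Y X, abs_div (Real.sin (X / 2) - Real.sin (Y / 2))]
    have h4 : |Real.sin (X / 2) - Real.sin (Y / 2)| / |X| ≤ |X - Y| / 2 / |X| := by gcongr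
    have h5 : |Real.sin (Y / 2) / Y| * (|X - Y| / |X|) ≤ 1 / 2 * (|X - Y| / |X|) := by
      gcongr; exact hb Y hY
    have : |X - Y| / 2 / |X| = 1 / 2 * (|X - Y| / |X|) := by ring
    linarith
  rw [h1, abs_mul]
  have h6 : |Real.sin (X / 2) / X + Real.sin (Y / 2) / Y| ≤ 1 :=
    (abs_add_le _ _).trans (by linarith [hb X hX, hb Y hY])
  calc _ ≤ |X - Y| / |X| * 1 := by gcongr
    _ = _ := mul_one _

lemma sum_natAbs (g : ℕ → ℝ) (hg : ∀ i, 0 ≤ g i) (L : ℕ) :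
    ∑ k ∈ Finset.Icc (-(L : ℤ)) L, g k.natAbs ≤ 2 * ∑ i ∈ Finset.range (L + 1), g i := by
  induction L with
  | zero => simp; linarith [hg 0]
  | succ L ih =>
    have : Finset.Icc (-((L + 1 : ℕ) : ℤ)) ((L + 1 : ℕ) : ℤ) =
        insert ((L + 1 : ℕ) : ℤ) (insert (-((L + 1 : ℕ) : ℤ)) (Finset.Icc (-(L : ℤ)) L)) := by
      ext j; simp only [Finset.mem_insert, Finset.mem_Icc]; omega
    rw [this, Finset.sum_insert (by simp only [Finset.mem_insert, Finset.mem_Icc]; omega),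
      Finset.sum_insert (by simp only [Finset.mem_Icc]; omega), Finset.sum_range_succ,
      Int.natAbs_neg, Int.natAbs_natCast]
    linarith

lemma harm_le (n : ℕ) : ∑ i ∈ Finset.range n, 1 / ((i : ℝ) + 1) ≤ 1 + Real.log n := by
  have := harmonic_le_one_add_log n
  simpa [harmonic] using this

lemma sum_center (N : ℕ) (k1 : ℤ) (hk : |k1| ≤ N) :
    ∑ k ∈ Finset.Icc (-(N : ℤ)) N, 1 / (1 + |(k : ℝ) - k1|) ≤
      2 * (1 + Real.log ((2 * N + 1 : ℕ) : ℝ)) := by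
  rw [abs_le] at hk
  have h1 : ∑ k ∈ Finset.Icc (-(N : ℤ)) N, 1 / (1 + |(k : ℝ) - k1|) =
      ∑ j ∈ Finset.Icc (-(N : ℤ) - k1) (N - k1), 1 / (((j.natAbs : ℕ) : ℝ) + 1) := by
    apply Finset.sum_bij' (fun k _ => k - k1) (fun j _ => j + k1)
    · intro a ha; simp only [Finset.mem_Icc] at *; omega
    · intro a ha; simp only [Finset.mem_Icc] at *; omega
    · intro a ha; ring
    · intro a ha; ring
    · intro a ha
      rw [Nat.cast_natAbs, add_comm]; push_cast; rfl
  rw [h1]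
  calc _ ≤ ∑ j ∈ Finset.Icc (-((2 * N : ℕ) : ℤ)) ((2 * N : ℕ) : ℤ),
          1 / (((j.natAbs : ℕ) : ℝ) + 1) := by
        apply Finset.sum_le_sum_of_subset_of_nonneg
        · intro a ha; simp only [Finset.mem_Icc] at *; omega
        · intros; positivity
    _ ≤ 2 * ∑ i ∈ Finset.range (2 * N + 1), 1 / ((i : ℝ) + 1) :=
        sum_natAbs (fun i => 1 / ((i : ℝ) + 1)) (fun i => by positivity) (2 * N)
    _ ≤ _ := by gcongr; exact harm_le _

lemma sum_edge (N : ℕ) :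
    ∑ k ∈ Finset.Icc (-(N : ℤ)) N, 1 / ((N : ℝ) + 1 - |(k : ℝ)|) ≤
      2 * (1 + Real.log ((2 * N + 1 : ℕ) : ℝ)) := by
  have h0 : ∑ k ∈ Finset.Icc (-(N : ℤ)) N, 1 / ((N : ℝ) + 1 - |(k : ℝ)|) =
      ∑ k ∈ Finset.Icc (-(N : ℤ)) N, 1 / (((N - k.natAbs : ℕ) : ℝ) + 1) := by
    apply Finset.sum_congr rfl
    intro k hk
    rw [Finset.mem_Icc] at hk
    rw [Nat.cast_sub (by omega), Nat.cast_natAbs]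
    push_cast
    ring_nf
  rw [h0]
  calc _ ≤ 2 * ∑ i ∈ Finset.range (N + 1), 1 / (((N - i : ℕ) : ℝ) + 1) :=
        sum_natAbs (fun i => 1 / (((N - i : ℕ) : ℝ) + 1)) (fun i => by positivity) N
    _ = 2 * ∑ i ∈ Finset.range (N + 1), 1 / ((i : ℝ) + 1) := by
        rw [← Finset.sum_range_reflect (fun i : ℕ => 1 / ((i : ℝ) + 1))]
        simp
    _ ≤ 2 * (1 + Real.log ((N + 1 : ℕ) : ℝ)) := by gcongr; exact harm_le _
    _ ≤ _ := by
        have : Real.log ((N + 1 : ℕ) : ℝ) ≤ Real.log ((2 * N + 1 : ℕ) : ℝ) := by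
          apply Real.log_le_log
          · positivity
          · norm_cast; omega
        linarith

lemma term_bound (δ : ℝ) (hδ : 0 < δ) (ν : ℝ → ℝ) (hν : IsNu ν) (N : ℕ) (hN : 2 ≤ N)
    (t : ℝ) (ht : 1 ≤ t) (k : ℤ) (hk : k ∈ Finset.Icc (-(N : ℤ)) (N : ℤ)) (l α x : ℝ)
    (hl : |l - ν ((k : ℝ) / N)| ≤
      (N : ℝ) ^ (δ / 4 - 2 / 3) * ((N : ℝ) + 1 - |(k : ℝ)|) ^ (-(1 : ℝ) / 3))
    (hx : ∀ u : ℝ, |u| ≤ 2 → |x - u| ≤ |-α / t - u|) :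
    |fejer (α + t * l) - fejer (α + t * ν ((k : ℝ) / N))| ≤
      4 * (N : ℝ) ^ (δ / 4) * (2 / (1 + |(k : ℝ) - 2 * N * scF x|)
        + 1 / ((N : ℝ) + 1 - |(k : ℝ)|)) := by
  have hNr : (2 : ℝ) ≤ N := by exact_mod_cast hN
  have hN0 : (0 : ℝ) < N := by linarith
  set M := (N : ℝ) ^ (δ / 4) with hM
  have hM1 : 1 ≤ M := Real.one_le_rpow (by linarith) (by positivity)
  set n := (N : ℝ) + 1 - |(k : ℝ)| with hn
  set D := |(k : ℝ) - 2 * N * scF x| with hD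
  have hD0 : 0 ≤ D := abs_nonneg _
  rw [Finset.mem_Icc] at hk
  have hkN : |k| ≤ (N : ℤ) := abs_le.mpr hk
  have hkr : |(k : ℝ)| ≤ N := by exact_mod_cast hkN
  have hn1 : 1 ≤ n := by linarith
  have hn0 : 0 < n := by linarith
  -- trivial bound usable if the bracket is at least one
  have triv : 1 ≤ 2 / (1 + D) + 1 / n →
      |fejer (α + t * l) - fejer (α + t * ν ((k : ℝ) / N))| ≤
      4 * M * (2 / (1 + D) + 1 / n) := by
    intro h
    have := fejer_diff_triv (α + t * l) (α + t * ν ((k : ℝ) / N))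
    nlinarith
  by_cases hD1 : D ≤ 1
  · apply triv
    have : 1 ≤ 2 / (1 + D) := by rw [le_div_iff₀ (by linarith)]; linarith
    have : 0 < 1 / n := by positivity
    linarith
  push Not at hD1
  by_cases hkN' : |k| = N
  · apply triv
    have h1 : |(k : ℝ)| = N := by exact_mod_cast hkN'
    have : n = 1 := by rw [hn, h1]; ring
    rw [this]
    have : 0 < 2 / (1 + D) := by positivity
    linarith
  have hn2 : 2 ≤ n := by
    have h1 : |k| + 1 ≤ (N : ℤ) := by omega
    have h2 : |(k : ℝ)| + 1 ≤ N := by exact_mod_cast h1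
    linarith
  clear triv
  have hkN1 : |(k : ℝ) / N| ≤ 1 := by
    rw [abs_div, abs_of_pos hN0, div_le_one hN0]; exact hkr
  have hmem : (k : ℝ) / N ∈ Set.Icc (-1 : ℝ) 1 := abs_le.mp hkN1
  set u := ν ((k : ℝ) / N) with hu
  have hu2 : |u| ≤ 2 := abs_le.mpr (hν.1 _ hmem)
  have hFu : scF u = (k : ℝ) / N / 2 := hν.2.2.2 _ hmem
  -- cube roots
  set A := (N : ℝ) ^ ((1 : ℝ) / 3) with hA
  set B := n ^ ((1 : ℝ) / 3) with hB
  have hA0 : 0 < A := by positivity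
  have hB0 : 0 < B := by positivity
  have hA3 : A ^ 3 = N := by
    rw [hA, ← Real.rpow_natCast, ← Real.rpow_mul hN0.le]; norm_num
  have hB3 : B ^ 3 = n := by
    rw [hB, ← Real.rpow_natCast, ← Real.rpow_mul hn0.le]; norm_num
  set q := B / A with hq
  have hq0 : 0 < q := by positivity
  have hq3 : q ^ 3 = n / N := by rw [hq, div_pow, hA3, hB3]
  have hr : (N : ℝ) ^ (δ / 4 - 2 / 3) * n ^ (-(1 : ℝ) / 3) = M / (q * N) := by
    have h1 : (N : ℝ) ^ (δ / 4 - 2 / 3) = M / A ^ 2 := by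
      rw [Real.rpow_sub hN0, ← hM, hA, ← Real.rpow_natCast, ← Real.rpow_mul hN0.le]
      norm_num
    have h2 : n ^ (-(1 : ℝ) / 3) = B⁻¹ := by
      rw [hB, ← Real.rpow_neg hn0.le]; norm_num
    rw [h1, h2, ← hA3, hq]
    field_simp
  rw [hr] at hl
  have hF2 : 1 - 2 * |scF u| = (n - 1) / N := by
    rw [hFu, abs_div, abs_div, abs_two, abs_of_pos hN0, hn]
    field_simp
    ring
  have hsep := scF_sep x u hu2 q hq0
    (by rw [hF2, hq3]; gcongr; linarith)
    (by rw [hF2, hq3, div_div, div_le_div_iff₀ (by positivity) hN0]; nlinarith)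
  have hFD : 2 * |scF x - scF u| = D / N := by
    have h1 : (k : ℝ) - 2 * N * scF x = -(2 * N * (scF x - scF u)) := by
      rw [hFu]; field_simp; ring
    rw [hD, h1, abs_neg, abs_mul, abs_of_pos (by positivity : (0 : ℝ) < 2 * N)]
    field_simp
  have hq2 : q ^ 2 / 4 = n / (4 * q * N) := by
    have : n = q ^ 3 * N := by rw [hq3]; field_simp
    rw [this]; field_simp
  rw [hFD, hq2] at hsep
  set m := min D n with hm
  have hm1 : 1 ≤ m := le_min hD1.le hn1
  have hm0 : 0 < m := by linarith
  have hsep' : m / (4 * q * N) ≤ |x - u| := by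
    rcases hsep with h | h
    · refine le_trans ?_ h
      rw [div_div, mul_comm (N : ℝ)]
      gcongr; exact min_le_left _ _
    · refine le_trans ?_ h
      gcongr; exact min_le_right _ _
  have ht0 : 0 < t := by linarith
  have hX : t * (m / (4 * q * N)) ≤ |α + t * u| := by
    have h1 : |α + t * u| = t * |-α / t - u| := by
      nth_rewrite 2 [← abs_of_pos ht0]
      rw [← abs_mul, ← abs_neg]
      congr 1
      field_simp
      ring
    rw [h1]
    have := hsep'.trans (hx u hu2)
    gcongr
  have hXpos : 0 < t * (m / (4 * q * N)) := by positivity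
  have hXne : α + t * u ≠ 0 := abs_pos.mp (hXpos.trans_le hX)
  have hXY : |α + t * u - (α + t * l)| ≤ t * (M / (q * N)) := by
    have : α + t * u - (α + t * l) = -(t * (l - u)) := by ring
    rw [this, abs_neg, abs_mul, abs_of_pos ht0]
    gcongr
  have hmain := fejer_diff (α + t * u) (α + t * l) hXne
  rw [abs_sub_comm]
  calc _ ≤ _ := hmain
    _ ≤ t * (M / (q * N)) / (t * (m / (4 * q * N))) := by gcongr
    _ = 4 * M * (1 / m) := by field_simp
    _ ≤ _ := by
      gcongr
      have h1 : 1 / D ≤ 2 / (1 + D) := by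
        rw [div_le_div_iff₀ (by linarith) (by linarith)]; linarith
      have h2 : 0 < 1 / n := by positivity
      have h3 : 0 < 1 / D := by positivity
      rcases min_choice D n with h | h <;> rw [hm, h] <;> linarith

/-- Deterministic core of the eigenvalue-replacement lemma: under the rigidity bound
`|λ_k − ν(k/N)| ≤ N^{δ/4−2/3} (N+1−|k|)^{-1/3}`, for `1 ≤ t ≤ N` one has
`sup_α ∑_k |φ(α + tλ_k) − φ(α + tν(k/N))| ≤ C N^{3δ/4}`. -/
theorem stmt17 (δ : ℝ) (hδ : 0 < δ) (ν : ℝ → ℝ) (hν : IsNu ν) :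
    ∃ C > (0 : ℝ), ∀ N : ℕ, 2 ≤ N → ∀ t : ℝ, 1 ≤ t → t ≤ N →
      ∀ lam : ℤ → ℝ,
        (∀ k ∈ Finset.Icc (-(N : ℤ)) (N : ℤ),
          |lam k - ν ((k : ℝ) / N)| ≤
            (N : ℝ) ^ (δ / 4 - 2 / 3) * ((N : ℝ) + 1 - |(k : ℝ)|) ^ (-(1 : ℝ) / 3)) →
        ∀ α : ℝ,
          ∑ k ∈ Finset.Icc (-(N : ℤ)) (N : ℤ),
            |fejer (α + t * lam k) - fejer (α + t * ν ((k : ℝ) / N))| ≤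
          C * (N : ℝ) ^ (3 * δ / 4) := by
  refine ⟨48 * (4 + 2 / δ), by positivity, ?_⟩
  intro N hN t ht htN lam hlam α
  have hNr : (2 : ℝ) ≤ N := by exact_mod_cast hN
  have hN0 : (0 : ℝ) < N := by linarith
  set y := -α / t with hy
  obtain ⟨x, hx2, hx⟩ : ∃ x : ℝ, |x| ≤ 2 ∧ ∀ u : ℝ, |u| ≤ 2 → |x - u| ≤ |-α / t - u| := by
    rw [← hy]
    rcases le_total y (-2) with h | h
    · refine ⟨-2, by norm_num, fun u hu => ?_⟩
      rw [abs_le] at hu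
      rw [abs_of_nonpos (by linarith), abs_of_nonpos (by linarith)]; linarith
    rcases le_total 2 y with h' | h'
    · refine ⟨2, by norm_num, fun u hu => ?_⟩
      rw [abs_le] at hu
      rw [abs_of_nonneg (by linarith), abs_of_nonneg (by linarith)]; linarith
    · exact ⟨y, abs_le.mpr ⟨h, h'⟩, fun u _ => le_rfl⟩
  set M := (N : ℝ) ^ (δ / 4) with hM
  have hM0 : 0 < M := by positivity
  set k0 := 2 * (N : ℝ) * scF x with hk0
  have hF := abs_le.mp (scF_bound x hx2)
  have hk1 : |⌊k0⌋| ≤ (N : ℤ) := by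
    rw [abs_le]
    constructor
    · rw [Int.le_floor]; push_cast; nlinarith
    · have h1 : (⌊k0⌋ : ℝ) ≤ N := (Int.floor_le k0).trans (by nlinarith)
      exact_mod_cast h1
  set L := 1 + Real.log ((2 * N + 1 : ℕ) : ℝ) with hL
  have hterm : ∀ k ∈ Finset.Icc (-(N : ℤ)) (N : ℤ),
      |fejer (α + t * lam k) - fejer (α + t * ν ((k : ℝ) / N))| ≤
      4 * M * (4 * (1 / (1 + |(k : ℝ) - ⌊k0⌋|)) + 1 / ((N : ℝ) + 1 - |(k : ℝ)|)) := by
    intro k hk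
    refine (term_bound δ hδ ν hν N hN t ht k hk (lam k) α x (hlam k hk) hx).trans ?_
    rw [← hk0, ← hM]
    have h1 : |(k : ℝ) - ⌊k0⌋| ≤ |(k : ℝ) - k0| + 1 := by
      have h2 := abs_sub_le (k : ℝ) k0 ⌊k0⌋
      have h3 : |k0 - ⌊k0⌋| ≤ 1 := by
        rw [abs_le]
        have := Int.floor_le k0
        have := Int.lt_floor_add_one k0
        constructor <;> linarith
      linarith
    have h2 : 2 / (1 + |(k : ℝ) - k0|) ≤ 4 * (1 / (1 + |(k : ℝ) - ⌊k0⌋|)) := by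
      have := abs_nonneg ((k : ℝ) - k0)
      have := abs_nonneg ((k : ℝ) - ⌊k0⌋)
      rw [mul_one_div, div_le_div_iff₀ (by linarith) (by linarith)]
      linarith
    gcongr
  have hsum : ∑ k ∈ Finset.Icc (-(N : ℤ)) (N : ℤ),
      |fejer (α + t * lam k) - fejer (α + t * ν ((k : ℝ) / N))| ≤ 4 * M * (10 * L) := by
    refine (Finset.sum_le_sum hterm).trans ?_
    rw [← Finset.mul_sum, Finset.sum_add_distrib, ← Finset.mul_sum]
    have h1 := sum_center N ⌊k0⌋ hk1
    have h2 := sum_edge N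
    rw [← hL] at h1 h2
    gcongr
    linarith
  have hLb : L ≤ (4 + 2 / δ) * (N : ℝ) ^ (δ / 2) := by
    have h1 : Real.log ((2 * N + 1 : ℕ) : ℝ) ≤ Real.log (4 * N) := by
      apply Real.log_le_log (by positivity)
      push_cast; linarith
    rw [Real.log_mul (by norm_num) hN0.ne'] at h1
    have h2 : Real.log 4 ≤ 3 := by
      have := Real.log_le_sub_one_of_pos (x := 4) (by norm_num); linarith
    have h3 := Real.log_le_rpow_div hN0.le (by positivity : 0 < δ / 2)
    have h4 : (N : ℝ) ^ (δ / 2) / (δ / 2) = 2 / δ * (N : ℝ) ^ (δ / 2) := by field_simp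
    have h5 : 1 ≤ (N : ℝ) ^ (δ / 2) := Real.one_le_rpow (by linarith) (by positivity)
    rw [hL]
    nlinarith
  have hpow : M * (N : ℝ) ^ (δ / 2) = (N : ℝ) ^ (3 * δ / 4) := by
    rw [hM, ← Real.rpow_add hN0]; congr 1; ring
  calc _ ≤ _ := hsum
    _ ≤ 4 * M * (10 * ((4 + 2 / δ) * (N : ℝ) ^ (δ / 2))) := by gcongr
    _ = 40 * (4 + 2 / δ) * (M * (N : ℝ) ^ (δ / 2)) := by ring
    _ ≤ _ := by rw [hpow]; gcongr; norm_num
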